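/- Let G = (V, E) be a finite τ-critical simple graph of order n = |V| with transversal number τ(G) = t. Then 2·(|V| + |E|) ≤ 2n + n(2t − n + 1). -/

import Mathlib

open SimpleGraph

/-- A transversal set (vertex cover): a set of vertices meeting every edge. -/
def IsTransversal {V : Type*} (G : SimpleGraph V) (S : Set V) : Prop :=
  ∀ ⦃u v : V⦄, G.Adj u v → u ∈ S ∨ v ∈ S

/-- The transversal number: minimum cardinality of a transversal set. -/
noncomputable def tau {V : Type*} [Fintype V] (G : SimpleGraph V) : ℕ :=
  sInf {n | ∃ S : Finset V, IsTransversal G ↑S ∧ S.card = n}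

/-- A graph with no isolated vertices is τ-critical if deleting any edge
decreases the transversal number by one. -/
def TauCritical {V : Type*} [Fintype V] (G : SimpleGraph V) : Prop :=
  (∀ v : V, ∃ u, G.Adj v u) ∧
  ∀ e ∈ G.edgeSet, tau (G.deleteEdges {e}) = tau G - 1

section Hajnal

/-- `T` spans exactly the edge `vu`. -/
def SpansOnly {V : Type*} (G : SimpleGraph V) (v u : V) (T : Finset V) : Prop :=
  v ∈ T ∧ u ∈ T ∧ ∀ a ∈ T, ∀ b ∈ T, G.Adj a b → (a = v ∧ b = u) ∨ (a = u ∧ b = v)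

variable {V : Type*} [Fintype V] [DecidableEq V] (G : SimpleGraph V) [DecidableRel G.Adj]

/-- The set of vertices adjacent to some vertex of `X`. -/
def neighborsOf (X : Finset V) : Finset V := X.biUnion fun x => G.neighborFinset x

variable {G}

lemma mem_neighborsOf {X : Finset V} {w : V} : w ∈ neighborsOf G X ↔ ∃ x ∈ X, G.Adj x w := by
  simp [neighborsOf]

lemma neighborsOf_mono {X Y : Finset V} (h : X ⊆ Y) : neighborsOf G X ⊆ neighborsOf G Y :=
  Finset.biUnion_subset_biUnion_of_subset_left _ h

lemma disjoint_neighborsOf {X : Finset V} (hX : ∀ a ∈ X, ∀ b ∈ X, ¬G.Adj a b) :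
    Disjoint X (neighborsOf G X) := by
  rw [Finset.disjoint_left]
  intro a ha h
  obtain ⟨b, hb, hab⟩ := mem_neighborsOf.1 h
  exact hX b hb a ha hab

/-- Exchanging `T ∩ N(X)` for `X` in a set `T` spanning a single edge at `X` yields an
independent set, which bounds `T ∩ N(X)` from below. -/
lemma card_sdiff_lt_card_inter_neighborsOf {α : ℕ}
    (hα : ∀ S : Finset V, (∀ a ∈ S, ∀ b ∈ S, ¬G.Adj a b) → S.card ≤ α)
    {X T : Finset V} {v u : V} (hX : ∀ a ∈ X, ∀ b ∈ X, ¬G.Adj a b) (hv : v ∈ X)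
    (hvu : G.Adj v u) (hT : SpansOnly G v u T) (hcard : T.card = α + 1) :
    (X \ T).card + 1 ≤ (T ∩ neighborsOf G X).card := by
  obtain ⟨-, -, hspan⟩ := hT
  have hu : u ∈ neighborsOf G X := mem_neighborsOf.2 ⟨v, hv, hvu⟩
  have hindep := hα ((T \ neighborsOf G X) ∪ (X \ T)) (by
    have hnot : ∀ a ∈ X, ∀ b, G.Adj a b → b ∈ neighborsOf G X :=
      fun a ha b hab => mem_neighborsOf.2 ⟨a, ha, hab⟩
    intro a ha b hb hab
    simp only [Finset.mem_union, Finset.mem_sdiff] at ha hb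
    rcases ha with ⟨ha, ha'⟩ | ⟨ha, -⟩ <;> rcases hb with ⟨hb, hb'⟩ | ⟨hb, -⟩
    · rcases hspan a ha b hb hab with ⟨-, rfl⟩ | ⟨rfl, -⟩ <;> contradiction
    · exact ha' (hnot b hb a hab.symm)
    · exact hb' (hnot a ha b hab)
    · exact hX a ha b hb hab)
  rw [Finset.card_union_of_disjoint
    (Finset.disjoint_of_subset_left Finset.sdiff_subset Finset.disjoint_sdiff)] at hindep
  have := Finset.card_inter_add_card_sdiff T (neighborsOf G X)
  omega

/-- In an α-critical graph without isolated vertices, an independent set `X` satisfies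
`|N(X)| - |X| ≥ deg v - 1` for each `v ∈ X`. -/
lemma card_add_degree_le_card_neighborsOf {α : ℕ} (hiso : ∀ v, ∃ u, G.Adj v u)
    (hα : ∀ S : Finset V, (∀ a ∈ S, ∀ b ∈ S, ¬G.Adj a b) → S.card ≤ α)
    (hcrit : ∀ v u, G.Adj v u → ∃ T : Finset V, SpansOnly G v u T ∧ T.card = α + 1)
    (X : Finset V) (hX : ∀ a ∈ X, ∀ b ∈ X, ¬G.Adj a b) (v : V) (hv : v ∈ X) :
    X.card + G.degree v ≤ (neighborsOf G X).card + 1 := by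
  induction X using Finset.strongInduction generalizing v with
  | H X ih =>
  choose! T hT hTcard using hcrit
  by_cases hsub : ∀ u, G.Adj v u → X ⊆ T v u
  · have hle : (neighborsOf G (X.erase v)).card + G.degree v ≤ (neighborsOf G X).card := by
      rw [← G.card_neighborFinset_eq_degree, ← Finset.card_union_of_disjoint]
      · refine Finset.card_le_card (Finset.union_subset
          (neighborsOf_mono (Finset.erase_subset _ _)) fun w hw => ?_)
        exact mem_neighborsOf.2 ⟨v, hv, by simpa using hw⟩
      · rw [Finset.disjoint_left]
        intro z hz hvz
        rw [mem_neighborFinset] at hvz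
        obtain ⟨w, hw, hwz⟩ := mem_neighborsOf.1 hz
        obtain ⟨hwv, hw⟩ := Finset.mem_erase.1 hw
        rcases (hT v z hvz).2.2 w (hsub z hvz hw) z (hT v z hvz).2.1 hwz with h | h
        · exact hwv h.1
        · exact hvz.ne h.2.symm
    have hcard := Finset.card_erase_add_one hv
    rcases (X.erase v).eq_empty_or_nonempty with h | ⟨w, hw⟩
    · rw [h] at hcard
      simp only [Finset.card_empty] at hcard
      omega
    · have := ih _ (Finset.erase_ssubset hv) (fun a ha b hb =>
        hX a (Finset.mem_of_mem_erase ha) b (Finset.mem_of_mem_erase hb)) w hw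
      have := (G.degree_pos_iff_exists_adj w).2 (hiso w)
      omega
  · push Not at hsub
    obtain ⟨u, hvu, hnot⟩ := hsub
    have hspan := hT v u hvu
    have hexch := card_sdiff_lt_card_inter_neighborsOf hα hX hv hvu hspan (hTcard v u hvu)
    have hss : X ∩ T v u ⊂ X := Finset.inter_subset_left.ssubset_of_ne
      fun h => hnot (Finset.inter_eq_left.1 h)
    have hih := ih _ hss (fun a ha b hb => hX a (hss.1 ha) b (hss.1 hb)) v
      (Finset.mem_inter.2 ⟨hv, hspan.1⟩)
    have hle : (neighborsOf G (X ∩ T v u)).card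
        + ((T v u ∩ neighborsOf G X).erase u).card ≤ (neighborsOf G X).card := by
      rw [← Finset.card_union_of_disjoint]
      · exact Finset.card_le_card (Finset.union_subset (neighborsOf_mono hss.1)
          ((Finset.erase_subset _ _).trans Finset.inter_subset_right))
      · rw [Finset.disjoint_left]
        intro z hz hz'
        obtain ⟨w, hw, hwz⟩ := mem_neighborsOf.1 hz
        simp only [Finset.mem_erase, Finset.mem_inter] at hz' hw
        rcases hspan.2.2 w hw.2 z hz'.2.1 hwz with h | h
        · exact hz'.1 h.2
        · exact hX v hv u (h.1 ▸ hw.1) hvu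
    have := Finset.card_erase_add_one
      (Finset.mem_inter.2 ⟨hspan.2.1, mem_neighborsOf.2 ⟨v, hv, hvu⟩⟩)
    have := Finset.card_inter_add_card_sdiff X (T v u)
    omega

/-- Hajnal's degree bound for α-critical graphs without isolated vertices. -/
lemma two_mul_add_degree_le {α : ℕ} (hiso : ∀ v, ∃ u, G.Adj v u)
    (hα : ∀ S : Finset V, (∀ a ∈ S, ∀ b ∈ S, ¬G.Adj a b) → S.card ≤ α)
    (hcrit : ∀ v u, G.Adj v u → ∃ T : Finset V, SpansOnly G v u T ∧ T.card = α + 1)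
    (v : V) : 2 * α + G.degree v ≤ Fintype.card V + 1 := by
  obtain ⟨u, hvu⟩ := hiso v
  obtain ⟨T, ⟨hvT, huT, hT⟩, hcard⟩ := hcrit v u hvu
  have hX : ∀ a ∈ T.erase u, ∀ b ∈ T.erase u, ¬G.Adj a b := by
    intro a ha b hb hab
    rw [Finset.mem_erase] at ha hb
    rcases hT a ha.2 b hb.2 hab with h | h
    · exact hb.1 h.2
    · exact ha.1 h.1
  have hdeg := card_add_degree_le_card_neighborsOf hiso hα hcrit _ hX v
    (Finset.mem_erase.2 ⟨hvu.ne, hvT⟩)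
  have hle := Finset.card_le_univ (T.erase u ∪ neighborsOf G (T.erase u))
  rw [Finset.card_union_of_disjoint (disjoint_neighborsOf hX)] at hle
  have := Finset.card_erase_add_one huT
  omega

end Hajnal

section Transversal

variable {V : Type*} [Fintype V] {G : SimpleGraph V}

lemma tau_le_card {S : Finset V} (hS : IsTransversal G ↑S) : tau G ≤ S.card :=
  Nat.sInf_le ⟨S, hS, rfl⟩

variable (G) in
lemma exists_isTransversal_card_eq_tau :
    ∃ S : Finset V, IsTransversal G ↑S ∧ S.card = tau G :=
  Nat.sInf_mem (s := {n | ∃ S : Finset V, IsTransversal G ↑S ∧ S.card = n})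
    ⟨_, Finset.univ, fun u _ _ => Or.inl (by simp), rfl⟩

lemma card_le_card_sub_tau [DecidableEq V] {S : Finset V} (hS : ∀ a ∈ S, ∀ b ∈ S, ¬G.Adj a b) :
    S.card ≤ Fintype.card V - tau G := by
  have h : tau G ≤ Sᶜ.card := tau_le_card fun a b hab => by
    by_contra! h
    simp only [Finset.coe_compl, Set.mem_compl_iff, Finset.mem_coe, not_not] at h
    exact hS a h.1 b h.2 hab
  have := Finset.card_add_card_compl S
  omega

lemma TauCritical.exists_spansOnly [DecidableEq V] (hcrit : TauCritical G) {v u : V} (hvu : G.Adj v u) :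
    ∃ T : Finset V, SpansOnly G v u T ∧ T.card = Fintype.card V - tau G + 1 := by
  obtain ⟨C, hC, hcard⟩ := exists_isTransversal_card_eq_tau (G.deleteEdges {s(v, u)})
  rw [hcrit.2 s(v, u) hvu] at hcard
  have hcover : ∀ a b, G.Adj a b → a ∉ C → b ∉ C → (a = v ∧ b = u) ∨ (a = u ∧ b = v) := by
    intro a b hab ha hb
    by_contra hne
    have hadj : (G.deleteEdges {s(v, u)}).Adj a b := by
      rw [deleteEdges_adj]
      exact ⟨hab, by simpa [Sym2.eq_iff] using hne⟩
    rcases hC hadj with h | h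
    · exact ha h
    · exact hb h
  have hpos : tau G ≠ 0 := by
    intro h
    obtain ⟨S, hS, hS0⟩ := exists_isTransversal_card_eq_tau G
    rw [h, Finset.card_eq_zero] at hS0
    simpa [hS0] using hS hvu
  have hends : v ∉ C ∧ u ∉ C := by
    by_contra hmem
    have : tau G ≤ C.card := tau_le_card fun a b hab => by
      by_contra! h
      rcases hcover a b hab h.1 h.2 with ⟨rfl, rfl⟩ | ⟨rfl, rfl⟩
      · exact hmem h
      · exact hmem h.symm
    omega
  refine ⟨Cᶜ, ⟨by simpa using hends.1, by simpa using hends.2, fun a ha b hb hab =>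
    hcover a b hab (by simpa using ha) (by simpa using hb)⟩, ?_⟩
  have := Finset.card_add_card_compl C
  have := tau_le_card (G := G) (S := Finset.univ) fun u _ _ => Or.inl (by simp)
  rw [Finset.card_univ] at this
  omega

end Transversal

theorem twice_order_plus_size_bound {V : Type*} [Fintype V] [DecidableEq V]
    (G : SimpleGraph V) [DecidableRel G.Adj] (n t : ℕ)
    (hcrit : TauCritical G) (hn : Fintype.card V = n) (ht : tau G = t) :
    (2 * (Fintype.card V + G.edgeFinset.card) : ℤ) ≤ 2 * n + n * (2 * t - n + 1) := by
  have hdeg : ∀ v ∈ Finset.univ, (G.degree v : ℤ) ≤ 2 * t - n + 1 := by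
    intro v _
    have := two_mul_add_degree_le hcrit.1 (fun _ => card_le_card_sub_tau)
      (fun _ _ => hcrit.exists_spansOnly) v
    omega
  have hsum := Finset.sum_le_card_nsmul _ _ _ hdeg
  rw [← Nat.cast_sum, G.sum_degrees_eq_twice_card_edges, Finset.card_univ, hn,
    nsmul_eq_mul] at hsum
  push_cast at hsum
  rw [hn]
  linarith
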